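/- (Merit function bound) Let ε ∈ (0, 3/4), λ > 0, L > 0, L' > 0, and let f : ℝ^{n×p} → ℝ be twice continuously differentiable. Fix X ∈ St(p,n)^ε and assume: (i) ‖∇f(X)‖_F ≤ L'; (ii) the Hessian of f at X, viewed as a linear operator on ℝ^{n×p} with the Frobenius norm, has operator norm at most L. Set L̂ := max{L, L'} and let μ ≥ (2/(3−4ε))·( L(1−ε) + 3√(1+ε)·L' + 2L̂²(1+ε)/λ ). Then for every g ∈ ℝ^{n×p}, the gradient ∇m(X) of the merit function m(Y) := f(Y) − (1/2)⟨sym(Yᵀ∇f(Y)), YᵀY − I_p⟩ + μN(Y) satisfies ⟨Λ̃(X;g), ∇m(X)⟩ ≥ (1/4)‖grad f(X)‖_F² + (1/4)‖skew(g Xᵀ)X‖_F² + λμ·N(X) − ‖g − ∇f(X)‖_F². -/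

import Mathlib

open Matrix Finset

noncomputable section

/-- Frobenius inner product `⟨A, B⟩ = Tr (Aᵀ * B)`. -/
def finner {n p : ℕ} (A B : Matrix (Fin n) (Fin p) ℝ) : ℝ :=
  (Aᵀ * B).trace

/-- Frobenius norm `‖A‖_F = √(Tr (Aᵀ * A))`. -/
def fnorm {n p : ℕ} (A : Matrix (Fin n) (Fin p) ℝ) : ℝ :=
  Real.sqrt ((Aᵀ * A).trace)

/-- Skew-symmetric part `skew M = (M - Mᵀ)/2`. -/
def skewPart {m : ℕ} (M : Matrix (Fin m) (Fin m) ℝ) : Matrix (Fin m) (Fin m) ℝ :=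
  (1 / 2 : ℝ) • (M - Mᵀ)

/-- Symmetric part `sym M = (M + Mᵀ)/2`. -/
def symPart {m : ℕ} (M : Matrix (Fin m) (Fin m) ℝ) : Matrix (Fin m) (Fin m) ℝ :=
  (1 / 2 : ℝ) • (M + Mᵀ)

/-- Penalty function `N(X) = ‖XᵀX - I‖_F² / 4`. -/
def penaltyN {n p : ℕ} (X : Matrix (Fin n) (Fin p) ℝ) : ℝ :=
  (1 / 4 : ℝ) * fnorm (Xᵀ * X - 1) ^ 2

/-- Landing direction `Λ̃(X; g) = skew(g Xᵀ) X + λ X (XᵀX - I)` with gradient estimate `g`. -/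
def landingDir {n p : ℕ} (lam : ℝ) (X g : Matrix (Fin n) (Fin p) ℝ) :
    Matrix (Fin n) (Fin p) ℝ :=
  skewPart (g * Xᵀ) * X + lam • (X * (Xᵀ * X - 1))

attribute [local instance] Matrix.frobeniusNormedAddCommGroup Matrix.frobeniusNormedSpace

lemma finner_eq_sum {n p : ℕ} (A B : Matrix (Fin n) (Fin p) ℝ) :
    finner A B = ∑ i, ∑ j, A i j * B i j := by
  simp only [finner, Matrix.trace, Matrix.diag, Matrix.mul_apply, Matrix.transpose_apply]
  exact Finset.sum_comm

lemma finner_comm {n p : ℕ} (A B : Matrix (Fin n) (Fin p) ℝ) : finner A B = finner B A := by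
  simp only [finner_eq_sum, mul_comm]

lemma finner_add_left {n p : ℕ} (A B C : Matrix (Fin n) (Fin p) ℝ) :
    finner (A + B) C = finner A C + finner B C := by
  simp [finner, Matrix.add_mul]

lemma finner_add_right {n p : ℕ} (A B C : Matrix (Fin n) (Fin p) ℝ) :
    finner A (B + C) = finner A B + finner A C := by
  simp [finner, Matrix.mul_add]

lemma finner_sub_left {n p : ℕ} (A B C : Matrix (Fin n) (Fin p) ℝ) :
    finner (A - B) C = finner A C - finner B C := by
  simp [finner, Matrix.sub_mul]

lemma finner_sub_right {n p : ℕ} (A B C : Matrix (Fin n) (Fin p) ℝ) :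
    finner A (B - C) = finner A B - finner A C := by
  simp [finner, Matrix.mul_sub]

lemma finner_smul_left {n p : ℕ} (c : ℝ) (A B : Matrix (Fin n) (Fin p) ℝ) :
    finner (c • A) B = c * finner A B := by
  simp [finner]

lemma finner_smul_right {n p : ℕ} (c : ℝ) (A B : Matrix (Fin n) (Fin p) ℝ) :
    finner A (c • B) = c * finner A B := by
  simp [finner]

lemma finner_neg_left {n p : ℕ} (A B : Matrix (Fin n) (Fin p) ℝ) :
    finner (-A) B = -finner A B := by
  simp [finner]

lemma finner_transpose {n p : ℕ} (A B : Matrix (Fin n) (Fin p) ℝ) :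
    finner Aᵀ Bᵀ = finner A B := by
  simp only [finner_eq_sum, Matrix.transpose_apply]
  exact Finset.sum_comm

lemma finner_mul_left {n k p : ℕ} (M : Matrix (Fin n) (Fin k) ℝ) (A : Matrix (Fin k) (Fin p) ℝ)
    (B : Matrix (Fin n) (Fin p) ℝ) : finner (M * A) B = finner A (Mᵀ * B) := by
  simp [finner, Matrix.transpose_mul, Matrix.mul_assoc]

lemma finner_mul_right {n k p : ℕ} (A : Matrix (Fin n) (Fin k) ℝ) (M : Matrix (Fin k) (Fin p) ℝ)
    (B : Matrix (Fin n) (Fin p) ℝ) : finner (A * M) B = finner A (B * Mᵀ) := by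
  simp only [finner, Matrix.transpose_mul, Matrix.mul_assoc]
  rw [Matrix.trace_mul_comm, Matrix.mul_assoc]

lemma finner_self_nonneg {n p : ℕ} (A : Matrix (Fin n) (Fin p) ℝ) : 0 ≤ finner A A := by
  rw [finner_eq_sum]
  exact Finset.sum_nonneg fun i _ => Finset.sum_nonneg fun j _ => mul_self_nonneg _

lemma fnorm_sq {n p : ℕ} (A : Matrix (Fin n) (Fin p) ℝ) : fnorm A ^ 2 = finner A A :=
  Real.sq_sqrt (finner_self_nonneg A)

lemma fnorm_nonneg {n p : ℕ} (A : Matrix (Fin n) (Fin p) ℝ) : 0 ≤ fnorm A :=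
  Real.sqrt_nonneg _

lemma fnorm_eq_norm {n p : ℕ} (A : Matrix (Fin n) (Fin p) ℝ) : fnorm A = ‖A‖ := by
  rw [Matrix.frobenius_norm_def, ← Real.sqrt_eq_rpow, fnorm]
  congr 1
  rw [← finner, finner_eq_sum]
  simp [← sq]

lemma fnorm_mul_le {n k p : ℕ} (A : Matrix (Fin n) (Fin k) ℝ) (B : Matrix (Fin k) (Fin p) ℝ) :
    fnorm (A * B) ≤ fnorm A * fnorm B := by
  simpa only [fnorm_eq_norm] using Matrix.frobenius_norm_mul A B

/-- Cauchy–Schwarz for the Frobenius inner product. -/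
lemma abs_finner_le {n p : ℕ} (A B : Matrix (Fin n) (Fin p) ℝ) :
    |finner A B| ≤ fnorm A * fnorm B := by
  apply abs_le_of_sq_le_sq _ (mul_nonneg (fnorm_nonneg A) (fnorm_nonneg B))
  rw [mul_pow, fnorm_sq, fnorm_sq, finner_eq_sum, finner_eq_sum, finner_eq_sum,
    ← Fintype.sum_prod_type', ← Fintype.sum_prod_type', ← Fintype.sum_prod_type']
  simpa only [sq] using Finset.sum_mul_sq_le_sq_mul_sq Finset.univ
    (fun x : Fin n × Fin p => A x.1 x.2) (fun x => B x.1 x.2)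

lemma skewPart_transpose {m : ℕ} (M : Matrix (Fin m) (Fin m) ℝ) :
    (skewPart M)ᵀ = -skewPart M := by
  simp [skewPart, ← smul_neg]

lemma skewPart_sub {m : ℕ} (M N : Matrix (Fin m) (Fin m) ℝ) :
    skewPart (M - N) = skewPart M - skewPart N := by
  simp only [skewPart, Matrix.transpose_sub, ← smul_sub]
  congr 1
  abel

lemma symPart_transpose {m : ℕ} (M : Matrix (Fin m) (Fin m) ℝ) :
    (symPart M)ᵀ = symPart M := by
  simp [symPart, add_comm]

lemma finner_skewPart_left {m : ℕ} (M : Matrix (Fin m) (Fin m) ℝ) {W : Matrix (Fin m) (Fin m) ℝ}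
    (hW : Wᵀ = -W) : finner (skewPart M) W = finner M W := by
  have h : finner Mᵀ W = -finner M W := by
    rw [← finner_transpose, hW, Matrix.transpose_transpose, finner_comm, finner_neg_left,
      finner_comm]
  rw [skewPart, finner_smul_left, finner_sub_left, h]
  ring

lemma finner_symPart_left {m : ℕ} (M : Matrix (Fin m) (Fin m) ℝ) {S : Matrix (Fin m) (Fin m) ℝ}
    (hS : Sᵀ = S) : finner (symPart M) S = finner M S := by
  have h : finner Mᵀ S = finner M S := by
    rw [← finner_transpose, hS, Matrix.transpose_transpose]
  rw [symPart, finner_smul_left, finner_add_left, h]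
  ring

lemma finner_symm_skew {m : ℕ} {S W : Matrix (Fin m) (Fin m) ℝ} (hS : Sᵀ = S) (hW : Wᵀ = -W) :
    finner S W = 0 := by
  have h := finner_transpose S W
  rw [hS, hW, finner_comm, finner_neg_left, finner_comm] at h
  linarith

lemma finner_mul_symm_skew_mul {n p : ℕ} (X : Matrix (Fin n) (Fin p) ℝ)
    {S : Matrix (Fin p) (Fin p) ℝ} {W : Matrix (Fin n) (Fin n) ℝ} (hS : Sᵀ = S) (hW : Wᵀ = -W) :
    finner (X * S) (W * X) = 0 := by
  rw [finner_comm, finner_mul_right]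
  rw [finner_comm]
  apply finner_symm_skew _ hW
  simp [Matrix.transpose_mul, hS, Matrix.mul_assoc]

/-- For a skew matrix `W` and a column vector `v`, `‖W v‖² ≤ ‖W‖² ‖v‖² / 2`. -/
lemma finner_skew_mul_col_le {n : ℕ} {W : Matrix (Fin n) (Fin n) ℝ} (hW : Wᵀ = -W)
    (v : Matrix (Fin n) (Fin 1) ℝ) :
    2 * finner (W * v) (W * v) ≤ finner W W * finner v v := by
  set s := finner v v with hs
  have hs0 : 0 ≤ s := finner_self_nonneg v
  set u := W * v with hu
  have one_by_one (a b c d : Matrix (Fin n) (Fin 1) ℝ) :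
      finner (a * bᵀ) (c * dᵀ) = finner a c * finner b d := by
    simp [finner_eq_sum, Matrix.mul_apply, Finset.sum_mul_sum]
    exact Finset.sum_congr rfl fun i _ => Finset.sum_congr rfl fun j _ => by ring
  have huv : finner u v = 0 := by
    have h1 : finner u v = finner v (Wᵀ * v) := finner_mul_left W v v
    rw [hW, Matrix.neg_mul, finner_comm v (-(W * v)), finner_neg_left, ← hu] at h1
    linarith
  have hvu : finner v u = 0 := by rw [finner_comm, huv]
  have hW1 : finner W (u * vᵀ) = finner u u := by
    rw [finner_comm, finner_mul_right, Matrix.transpose_transpose]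
  have hW2 : finner W (v * uᵀ) = -finner u u := by
    rw [← finner_transpose, hW, finner_neg_left, Matrix.transpose_mul,
      Matrix.transpose_transpose, hW1]
  have key := finner_self_nonneg (s • W - (u * vᵀ - v * uᵀ))
  have e : finner (s • W - (u * vᵀ - v * uᵀ)) (s • W - (u * vᵀ - v * uᵀ)) =
      s ^ 2 * finner W W - 2 * s * finner u u := by
    simp only [finner_sub_left, finner_sub_right, finner_smul_left, finner_smul_right,
      one_by_one, huv, hvu, hW1, hW2, finner_comm _ W, ← hs]
    ring
  rw [e] at key
  rcases hs0.eq_or_lt with h0 | hpos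
  · have hv : v = 0 := by
      have : fnorm v ^ 2 = 0 := by rw [fnorm_sq, ← hs, ← h0]
      rw [fnorm_eq_norm] at this
      simpa using this
    have : u = 0 := by rw [hu, hv, Matrix.mul_zero]
    simp [this, ← h0, finner_eq_sum]
  · nlinarith [key, hpos]

lemma finner_skew_mul_le {n k : ℕ} {W : Matrix (Fin n) (Fin n) ℝ} (hW : Wᵀ = -W)
    (B : Matrix (Fin n) (Fin k) ℝ) :
    2 * finner (W * B) (W * B) ≤ finner W W * finner B B := by
  have cols (C : Matrix (Fin n) (Fin k) ℝ) :
      finner C C = ∑ j, finner (C.submatrix id fun _ : Fin 1 => j)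
        (C.submatrix id fun _ : Fin 1 => j) := by
    simp only [finner_eq_sum]
    rw [Finset.sum_comm]
    simp
  rw [cols (W * B), cols B, Finset.mul_sum, Finset.mul_sum]
  refine Finset.sum_le_sum fun j _ => ?_
  exact finner_skew_mul_col_le hW (B.submatrix id fun _ : Fin 1 => j)

/-- Right multiplication of skew matrices by a nearly orthonormal `X`. -/
lemma finner_skew_mul_near_orthonormal_le {n p : ℕ} {W : Matrix (Fin n) (Fin n) ℝ} (hW : Wᵀ = -W)
    {X : Matrix (Fin n) (Fin p) ℝ} {ε : ℝ} (hε : ε < 1) (hX : fnorm (Xᵀ * X - 1) ≤ ε) :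
    finner (W * X) (W * X) ≤ (1 + 5 / 7 * ε) * finner W W := by
  set Δ := Xᵀ * X - 1 with hΔ
  have hS : Xᵀ * X = 1 + Δ := by rw [hΔ]; abel
  have hΔt : Δᵀ = Δ := by simp [hΔ, Matrix.transpose_mul]
  have hunit : IsUnit (1 + Δ) := by
    let _ : NormedRing (Matrix (Fin p) (Fin p) ℝ) := Matrix.frobeniusNormedRing
    have : ‖-Δ‖ < 1 := by
      rw [norm_neg, ← fnorm_eq_norm]
      linarith
    simpa using isUnit_one_sub_of_norm_lt_one this
  obtain ⟨T, hT1, hT2⟩ : ∃ T, T * (1 + Δ) = 1 ∧ (1 + Δ) * T = 1 :=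
    ⟨_, Matrix.nonsing_inv_mul _ ((Matrix.isUnit_iff_isUnit_det _).1 hunit),
      Matrix.mul_nonsing_inv _ ((Matrix.isUnit_iff_isUnit_det _).1 hunit)⟩
  have hTt : Tᵀ = T := by
    have h : Tᵀ * (1 + Δ) = 1 := by
      have h := congrArg Matrix.transpose hT2
      rwa [Matrix.transpose_mul, Matrix.transpose_add, hΔt, Matrix.transpose_one] at h
    calc Tᵀ = Tᵀ * ((1 + Δ) * T) := by rw [hT2, Matrix.mul_one]
      _ = T := by rw [← Matrix.mul_assoc, h, Matrix.one_mul]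
  have hTΔ : T * Δ = 1 - T := by
    rw [Matrix.mul_add, Matrix.mul_one] at hT1
    rw [← hT1]; abel
  have hΔT : Δ * T = 1 - T := by
    rw [Matrix.add_mul, Matrix.one_mul] at hT2
    rw [← hT2]; abel
  set K := X * (T * Δ) * Xᵀ with hK
  set J := X * T * Xᵀ with hJ
  have hJt : Jᵀ = J := by simp [hJ, Matrix.transpose_mul, hTt, Matrix.mul_assoc]
  have hJJ : J * J = J := by
    calc J * J = X * (T * (Xᵀ * X)) * T * Xᵀ := by simp only [hJ, Matrix.mul_assoc]
      _ = J := by rw [hS, hT1, Matrix.mul_one]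
  have hKJ : X * Xᵀ = K + J := by
    rw [hK, hJ, hTΔ, Matrix.mul_sub, Matrix.sub_mul, Matrix.mul_one]; abel
  have hKK : finner K K = finner Δ Δ := by
    have h1 : (Xᵀ * X) * (T * Δ) = Δ := by rw [hS, ← Matrix.mul_assoc, hT2, Matrix.one_mul]
    have h2 : (T * Δ) * (Xᵀ * X) = Δ := by
      rw [hTΔ, ← hΔT, hS, Matrix.mul_assoc, hT1, Matrix.mul_one]
    have h3 : (Xᵀ * X)ᵀ = Xᵀ * X := by simp [Matrix.transpose_mul]
    calc finner K K = finner (T * Δ) ((Xᵀ * X) * (T * Δ) * (Xᵀ * X)) := by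
          rw [hK, finner_mul_right, Matrix.mul_assoc, finner_mul_left, Matrix.transpose_transpose]
          simp only [Matrix.mul_assoc]
      _ = finner Δ Δ := by
          rw [h1, finner_comm, finner_mul_right, h3, h2]
  have hWW : fnorm (Wᵀ * W) ≤ 5 / 7 * finner W W := by
    have h := finner_skew_mul_le hW W
    apply abs_le_of_sq_le_sq' _ (by linarith [finner_self_nonneg W]) |>.2
    rw [fnorm_sq, hW, Matrix.neg_mul, finner_neg_left, finner_comm, finner_neg_left]
    nlinarith [sq_nonneg (finner W W)]
  have hproj : finner (W * J) W ≤ finner W W := by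
    have h := finner_self_nonneg (W - W * J)
    have h2 : finner (W * J) (W * J) = finner (W * J) W := by
      rw [finner_comm, finner_mul_right, hJt, Matrix.mul_assoc, hJJ, finner_comm]
    rw [finner_sub_left, finner_sub_right, finner_sub_right, h2, finner_comm W (W * J)] at h
    linarith
  have hKW : finner (W * K) W ≤ 5 / 7 * ε * finner W W := by
    rw [finner_mul_left]
    have h := (le_abs_self _).trans (abs_finner_le K (Wᵀ * W))
    have hKn : fnorm K = fnorm Δ := by
      have : fnorm K = √(finner K K) := rfl
      rw [this, hKK]; rfl
    rw [hKn] at h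
    have := fnorm_nonneg (Wᵀ * W)
    have := fnorm_nonneg Δ
    nlinarith [finner_self_nonneg W]
  have : finner (W * X) (W * X) = finner (W * K) W + finner (W * J) W := by
    rw [← finner_add_left, ← Matrix.mul_add, ← hKJ, finner_comm (W * (X * Xᵀ)),
      finner_mul_right, finner_comm, Matrix.mul_assoc, finner_comm]
  linarith

lemma isBoundedBilinearMap_matrix_mul (n k p : ℕ) :
    IsBoundedBilinearMap ℝ
      (fun x : Matrix (Fin n) (Fin k) ℝ × Matrix (Fin k) (Fin p) ℝ => x.1 * x.2) where
  add_left := fun _ _ _ => Matrix.add_mul _ _ _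
  smul_left := fun _ _ _ => Matrix.smul_mul _ _ _
  add_right := fun _ _ _ => Matrix.mul_add _ _ _
  smul_right := fun _ _ _ => Matrix.mul_smul _ _ _
  bound := ⟨1, one_pos, fun A B => by simpa using Matrix.frobenius_norm_mul A B⟩

lemma isBoundedBilinearMap_finner (n p : ℕ) :
    IsBoundedBilinearMap ℝ
      (fun x : Matrix (Fin n) (Fin p) ℝ × Matrix (Fin n) (Fin p) ℝ => finner x.1 x.2) where
  add_left := finner_add_left
  smul_left := finner_smul_left
  add_right := finner_add_right
  smul_right := finner_smul_right
  bound := ⟨1, one_pos, fun A B => by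
    simpa [← fnorm_eq_norm] using abs_finner_le A B⟩

lemma hasFDerivAt_matrix_transpose {n p : ℕ} (X : Matrix (Fin n) (Fin p) ℝ) :
    HasFDerivAt (fun Y : Matrix (Fin n) (Fin p) ℝ => Yᵀ)
      (Matrix.transposeLinearEquiv (Fin n) (Fin p) ℝ ℝ).toLinearMap.toContinuousLinearMap X :=
  (Matrix.transposeLinearEquiv (Fin n) (Fin p) ℝ ℝ).toLinearMap.toContinuousLinearMap.hasFDerivAt

lemma differentiableAt_of_fderiv_eq_finner {n p : ℕ} {f : Matrix (Fin n) (Fin p) ℝ → ℝ}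
    {gradf : Matrix (Fin n) (Fin p) ℝ → Matrix (Fin n) (Fin p) ℝ} (hC2 : ContDiff ℝ 2 f)
    (hgrad : ∀ Y H : Matrix (Fin n) (Fin p) ℝ, fderiv ℝ f Y H = finner (gradf Y) H)
    (X : Matrix (Fin n) (Fin p) ℝ) : DifferentiableAt ℝ gradf X := by
  have h : gradf = fun Y => ∑ i, ∑ j, (fderiv ℝ f Y (Matrix.single i j 1)) •
      (Matrix.single i j (1 : ℝ) : Matrix (Fin n) (Fin p) ℝ) := by
    funext Y
    conv_lhs => rw [Matrix.matrix_eq_sum_single (gradf Y)]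
    refine Finset.sum_congr rfl fun i _ => Finset.sum_congr rfl fun j _ => ?_
    rw [hgrad, finner_eq_sum]
    simp [Matrix.single_apply, Matrix.smul_single, ite_and]
  have hd : DifferentiableAt ℝ (fderiv ℝ f) X :=
    ((hC2.fderiv_right (m := 1) (by norm_num)).differentiable (by norm_num)) X
  rw [h]
  fun_prop

/-- The differential of the merit function. -/
lemma fderiv_merit {n p : ℕ} {μ : ℝ} {f m : Matrix (Fin n) (Fin p) ℝ → ℝ}
    {gradf : Matrix (Fin n) (Fin p) ℝ → Matrix (Fin n) (Fin p) ℝ} (hC2 : ContDiff ℝ 2 f)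
    (hgrad : ∀ Y H : Matrix (Fin n) (Fin p) ℝ, fderiv ℝ f Y H = finner (gradf Y) H)
    (hm : ∀ Y : Matrix (Fin n) (Fin p) ℝ,
      m Y = f Y - (1 / 2) * finner (symPart (Yᵀ * gradf Y)) (Yᵀ * Y - 1) + μ * penaltyN Y)
    (X D : Matrix (Fin n) (Fin p) ℝ) :
    fderiv ℝ m X D = finner (gradf X) D
      - (1 / 2) * finner (gradf X * (Xᵀ * X - 1)) D
      - (1 / 2) * finner (fderiv ℝ gradf X D) (X * (Xᵀ * X - 1))
      - finner (X * symPart (Xᵀ * gradf X)) D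
      + μ * finner (X * (Xᵀ * X - 1)) D := by
  have hf : HasFDerivAt f (fderiv ℝ f X) X :=
    (hC2.differentiable (by norm_num) X).hasFDerivAt
  have hg : HasFDerivAt gradf (fderiv ℝ gradf X) X :=
    (differentiableAt_of_fderiv_eq_finner hC2 hgrad X).hasFDerivAt
  have hT := hasFDerivAt_matrix_transpose X
  have hXG := ((isBoundedBilinearMap_matrix_mul p n p).hasFDerivAt (Xᵀ, gradf X)).comp X
    (hT.prodMk hg)
  have hXX := (((isBoundedBilinearMap_matrix_mul p n p).hasFDerivAt (Xᵀ, X)).comp (f := fun Y => (Yᵀ, Y)) X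
    (hT.prodMk (hasFDerivAt_id X))).sub_const 1
  have hS := (hXG.add ((hasFDerivAt_matrix_transpose (Xᵀ * gradf X)).comp X hXG)).const_smul
    (1 / 2 : ℝ)
  have h1 := ((isBoundedBilinearMap_finner p p).hasFDerivAt
    (symPart (Xᵀ * gradf X), Xᵀ * X - 1)).comp X (hS.prodMk hXX)
  have h2 := ((isBoundedBilinearMap_finner p p).hasFDerivAt
    (Xᵀ * X - 1, Xᵀ * X - 1)).comp X (hXX.prodMk hXX)
  have hmm := (hf.sub (h1.const_mul (1 / 2))).add ((h2.const_mul (1 / 4)).const_mul μ)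
  have hD := congrArg (fun T => T D) (hmm.congr_of_eventuallyEq (f₁ := m)
    (Filter.Eventually.of_forall fun Y => by
      have h := hm Y
      rw [penaltyN, fnorm_sq] at h
      exact h)).fderiv
  have hΔt : (Xᵀ * X - 1)ᵀ = Xᵀ * X - 1 := by simp [Matrix.transpose_mul]
  set Δ := Xᵀ * X - 1 with hΔ
  set K := fderiv ℝ gradf X D
  set G := gradf X
  have hs : symPart (Dᵀ * G + Xᵀ * K) = (1 / 2 : ℝ) • (Xᵀ * K + Dᵀ * G + (Xᵀ * K + Dᵀ * G)ᵀ) := by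
    rw [symPart, add_comm (Dᵀ * G)]
  have hD' : fderiv ℝ m X D = finner G D -
      (1 / 2) * (finner (symPart (Xᵀ * G)) (Xᵀ * D + Dᵀ * X) +
        finner (symPart (Dᵀ * G + Xᵀ * K)) Δ) +
      μ * (1 / 4 * (finner Δ (Xᵀ * D + Dᵀ * X) + finner (Xᵀ * D + Dᵀ * X) Δ)) := by
    rw [hs, ← hgrad]
    exact hD
  have hsymm {S : Matrix (Fin p) (Fin p) ℝ} (hS : Sᵀ = S) :
      finner S (Xᵀ * D + Dᵀ * X) = 2 * finner (X * S) D := by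
    have h : finner S (Dᵀ * X) = finner S (Xᵀ * D) := by
      rw [← finner_transpose, hS, Matrix.transpose_mul, Matrix.transpose_transpose]
    rw [finner_add_right, h, finner_mul_left]
    ring
  rw [hD', finner_comm (Xᵀ * D + Dᵀ * X), hsymm hΔt, hsymm (symPart_transpose _),
    finner_symPart_left _ hΔt, finner_add_left, finner_mul_left Xᵀ, Matrix.transpose_transpose]
  have : finner (Dᵀ * G) Δ = finner (G * Δ) D := by
    rw [finner_mul_left, Matrix.transpose_transpose, finner_comm, finner_mul_right, hΔt,
      finner_comm]
  rw [this]
  ring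

lemma skew_quadratic_bound {ε pp po oo rr aa ee : ℝ} (hε0 : 0 ≤ ε) (hε1 : ε ≤ 3 / 4)
    (hoo : 0 ≤ oo)
    (hsq : 0 ≤ (3 + 5 / 7 * ε) ^ 2 * pp - 4 * (3 + 5 / 7 * ε) * po + 4 * oo)
    (hrr : rr ≤ (1 + 5 / 7 * ε) * pp) (haa : aa ≤ (1 + 5 / 7 * ε) * oo)
    (hee : pp - 2 * po + oo ≤ (1 + 5 / 7 * ε) * ee) :
    1 / 4 * rr + (1 / 4 + (2 - ε) / (8 * (1 + ε))) * aa - ee ≤ po := by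
  obtain ⟨τ, hτ⟩ : ∃ τ, τ = 1 + 5 / 7 * ε := ⟨_, rfl⟩
  obtain ⟨c, hc⟩ : ∃ c, c = (2 - ε) / (8 * (1 + ε)) := ⟨_, rfl⟩
  have hc0 : 0 ≤ c := by rw [hc]; exact div_nonneg (by linarith) (by linarith)
  have hτ0 : 0 < τ := by rw [hτ]; linarith
  have hτ2 : 0 ≤ 2 - τ := by rw [hτ]; linarith
  have hcτ : 4 * c * τ * (2 + τ) ≤ (2 - τ) * (4 + τ) := by
    have h : (2 - ε) * (τ * (2 + τ)) ≤ 2 * (1 + ε) * ((2 - τ) * (4 + τ)) := by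
      rw [hτ]
      nlinarith [mul_nonneg hε0 (sub_nonneg.2 hε1),
        mul_nonneg (mul_nonneg hε0 hε0) (sub_nonneg.2 hε1)]
    have h2 : c * (8 * (1 + ε)) = 2 - ε := by
      rw [hc]; field_simp
    rw [← h2] at h
    have h3 : 0 < 2 * (1 + ε) := by linarith
    refine le_of_mul_le_mul_left ?_ h3
    linarith
  rw [← hc]
  have e3 : 3 + 5 / 7 * ε = 2 + τ := by rw [hτ]; ring
  rw [e3] at hsq
  rw [← hτ] at hrr haa hee
  have h1 := mul_nonneg hτ2 hsq
  have h2 := mul_nonneg (mul_nonneg hτ0.le (sub_nonneg.2 hcτ)) hoo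
  have h3 := mul_le_mul_of_nonneg_left hrr hτ0.le
  have h4 := mul_le_mul_of_nonneg_left haa (mul_nonneg hτ0.le (by linarith : 0 ≤ 1 + 4 * c))
  have h5 : 0 ≤ 4 * τ * po + 4 * τ * ee - τ * rr - τ * (1 + 4 * c) * aa := by
    have : 0 < 2 + τ := by linarith
    refine nonneg_of_mul_nonneg_right (a := 2 + τ) ?_ this
    have h6 : 0 ≤ (2 + τ) * ((4 * τ * po + 4 * (pp - 2 * po + oo) - τ * (τ * pp))
        - τ * (1 + 4 * c) * (τ * oo)) := by linarith
    refine h6.trans (mul_le_mul_of_nonneg_left ?_ this.le)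
    linarith
  nlinarith

lemma penalty_budget {ε lam L L' μ s Q δ w : ℝ} (hε1 : ε < 3 / 4)
    (hlam : 0 < lam) (hL : 0 ≤ L) (hL' : 0 ≤ L') (hs : 0 ≤ s) (hQ : 0 ≤ Q)
    (hμ : (2 / (3 - 4 * ε)) * (L * (1 - ε) + 3 * s * L' + 2 * Q / lam) ≤ μ)
    (hw : (1 - ε) * δ ^ 2 ≤ w ^ 2) :
    Q * (δ ^ 2 + w ^ 2) / (2 - ε) ≤
      lam * (μ * (w ^ 2 - δ ^ 2 / 4) - L * w ^ 2 / 2 - 3 / 2 * s * L' * δ ^ 2) := by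
  obtain ⟨v, hv⟩ : ∃ v, v = w ^ 2 - (1 - ε) * δ ^ 2 := ⟨_, rfl⟩
  have hv0 : 0 ≤ v := by linarith
  have hk : 0 < 3 - 4 * ε := by linarith
  obtain ⟨u, hu⟩ : ∃ u, u = v / (3 - 4 * ε) := ⟨_, rfl⟩
  have hvu : v = u * (3 - 4 * ε) := by rw [hu]; field_simp
  have hu0 : 0 ≤ u := by rw [hu]; positivity
  have hw2 : w ^ 2 = u * (3 - 4 * ε) + (1 - ε) * δ ^ 2 := by linarith
  have hB : 2 * (lam * (L * (1 - ε) + 3 * s * L') + 2 * Q) ≤ lam * μ * (3 - 4 * ε) := by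
    have h := mul_le_mul_of_nonneg_left hμ (mul_pos hlam hk).le
    calc _ = lam * (3 - 4 * ε) *
          ((2 / (3 - 4 * ε)) * (L * (1 - ε) + 3 * s * L' + 2 * Q / lam)) := by
            have := hk.ne'
            generalize 3 - 4 * ε = k at *
            field_simp
      _ ≤ _ := by linarith
  have h1 := mul_le_mul_of_nonneg_right hB (by positivity : 0 ≤ u + δ ^ 2 / 4)
  have h2 : Q * (δ ^ 2 + w ^ 2) / (2 - ε) ≤ Q * (4 * u + δ ^ 2) := by
    rw [div_le_iff₀ (by linarith), hw2, mul_assoc]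
    refine mul_le_mul_of_nonneg_left ?_ hQ
    nlinarith
  have h3 : 0 ≤ lam * L * u := by positivity
  have h4 : 0 ≤ lam * (s * L') * u := by positivity
  rw [hw2] at h2 ⊢
  nlinarith

lemma cross_term_bound {ε L L' δ w a : ℝ} (hε0 : 0 ≤ ε) (hε1 : ε < 3 / 4)
    (hL : 0 ≤ L) (hδ : 0 ≤ δ) (hw : 0 ≤ w) (ha : 0 ≤ a) :
    1 / 2 * (L' * δ * a + L * a * w) ≤
      (2 - ε) / (8 * (1 + ε)) * a ^ 2 +
        max L L' ^ 2 * (1 + ε) * (δ ^ 2 + w ^ 2) / (2 - ε) := by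
  obtain ⟨l, hl⟩ : ∃ l, l = max L L' := ⟨_, rfl⟩
  have hl1 : L ≤ l := hl ▸ le_max_left _ _
  have hl2 : L' ≤ l := hl ▸ le_max_right _ _
  have hl0 : 0 ≤ l := hL.trans hl1
  have h1 : L' * δ * a + L * a * w ≤ l * (δ + w) * a := by
    nlinarith [mul_le_mul_of_nonneg_right hl1 (mul_nonneg ha hw),
      mul_le_mul_of_nonneg_right hl2 (mul_nonneg hδ ha)]
  obtain ⟨c, hc⟩ : ∃ c, c = (2 - ε) / (8 * (1 + ε)) := ⟨_, rfl⟩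
  have hc0 : 0 < c := by rw [hc]; exact div_pos (by linarith) (by linarith)
  have e : l ^ 2 * (1 + ε) * (δ ^ 2 + w ^ 2) / (2 - ε) = l ^ 2 * (δ ^ 2 + w ^ 2) / (8 * c) := by
    have : (2 - ε) ≠ 0 := by linarith
    rw [hc]; field_simp
  rw [← hl, e, ← hc]
  have h2 : 1 / 2 * (l * (δ + w) * a) - c * a ^ 2 ≤ l ^ 2 * (δ ^ 2 + w ^ 2) / (8 * c) := by
    rw [le_div_iff₀ (by linarith)]
    nlinarith [sq_nonneg (l * (δ + w) - 4 * c * a), mul_nonneg (sq_nonneg l) (sq_nonneg (δ - w))]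
  linarith

lemma skew_cross_bound {n p : ℕ} {ε : ℝ} (hε0 : 0 ≤ ε) (hε1 : ε ≤ 3 / 4)
    {X : Matrix (Fin n) (Fin p) ℝ} (hX : fnorm (Xᵀ * X - 1) ≤ ε) (G g : Matrix (Fin n) (Fin p) ℝ) :
    1 / 4 * fnorm (skewPart (G * Xᵀ) * X) ^ 2 +
      (1 / 4 + (2 - ε) / (8 * (1 + ε))) * fnorm (skewPart (g * Xᵀ) * X) ^ 2 -
        fnorm (g - G) ^ 2 ≤ finner (skewPart (G * Xᵀ)) (skewPart (g * Xᵀ)) := by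
  set Ψ := skewPart (G * Xᵀ) with hΨ
  set Ω := skewPart (g * Xᵀ) with hΩ
  have hε : ε < 1 := by linarith
  simp only [fnorm_sq]
  refine skew_quadratic_bound hε0 hε1 (finner_self_nonneg Ω) (pp := finner Ψ Ψ) ?_
    (finner_skew_mul_near_orthonormal_le (skewPart_transpose _) hε hX)
    (finner_skew_mul_near_orthonormal_le (skewPart_transpose _) hε hX) ?_
  · have h := finner_self_nonneg ((3 + 5 / 7 * ε) • Ψ - (2 : ℝ) • Ω)
    simp only [finner_sub_left, finner_sub_right, finner_smul_left, finner_smul_right,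
      finner_comm Ω Ψ] at h
    linarith
  · have hZ : skewPart ((g - G) * Xᵀ) = Ω - Ψ := by rw [Matrix.sub_mul, skewPart_sub]
    set Z := skewPart ((g - G) * Xᵀ) with hZdef
    have hZt : Zᵀ = -Z := skewPart_transpose _
    have hzz : finner Z Z = finner (g - G) (Z * X) := by
      rw [hZdef, finner_skewPart_left _ hZt, finner_mul_right, Matrix.transpose_transpose]
    have hle := finner_skew_mul_near_orthonormal_le hZt hε hX
    have hcs := (le_abs_self _).trans (abs_finner_le (g - G) (Z * X))
    rw [← hzz] at hcs
    have he : finner Ψ Ψ - 2 * finner Ψ Ω + finner Ω Ω = finner Z Z := by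
      rw [hZ]
      simp only [finner_sub_left, finner_sub_right, finner_comm Ω Ψ]
      ring
    rw [he]
    have hz0 := finner_self_nonneg Z
    have h2 : finner Z Z ^ 2 ≤ finner (g - G) (g - G) * finner (Z * X) (Z * X) := by
      rw [← fnorm_sq (g - G), ← fnorm_sq (Z * X), ← mul_pow]
      exact pow_le_pow_left₀ hz0 hcs 2
    have h3 := h2.trans (mul_le_mul_of_nonneg_left hle (finner_self_nonneg (g - G)))
    have he0 := finner_self_nonneg (g - G)
    rcases hz0.eq_or_lt with h0 | hpos
    · rw [← h0]
      exact mul_nonneg (by linarith) he0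
    · refine le_of_mul_le_mul_right ?_ hpos
      linarith

lemma fnorm_mul_defect_sq_bounds {n p : ℕ} (X : Matrix (Fin n) (Fin p) ℝ) {ε : ℝ}
    (hX : fnorm (Xᵀ * X - 1) ≤ ε) :
    (1 - ε) * fnorm (Xᵀ * X - 1) ^ 2 ≤ fnorm (X * (Xᵀ * X - 1)) ^ 2 ∧
      fnorm (X * (Xᵀ * X - 1)) ^ 2 ≤ (1 + ε) * fnorm (Xᵀ * X - 1) ^ 2 := by
  set Δ := Xᵀ * X - 1 with hΔ
  have hS : Xᵀ * X = 1 + Δ := by rw [hΔ]; abel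
  have h : fnorm (X * Δ) ^ 2 = fnorm Δ ^ 2 + finner Δ (Δ * Δ) := by
    rw [fnorm_sq, fnorm_sq, finner_mul_left, ← Matrix.mul_assoc, hS, Matrix.add_mul,
      Matrix.one_mul, finner_add_right]
  have h1 := abs_finner_le Δ (Δ * Δ)
  have h2 : fnorm Δ * fnorm (Δ * Δ) ≤ ε * fnorm Δ ^ 2 := by
    have h3 := fnorm_mul_le Δ Δ
    have h4 := fnorm_nonneg Δ
    nlinarith [fnorm_nonneg (Δ * Δ)]
  have h3 := abs_le.1 (h1.trans h2)
  constructor <;> linarith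

/-- merit function bound. -/
theorem merit_function_bound {n p : ℕ} (ε lam L L' μ : ℝ)
    (hε : ε ∈ Set.Ioo (0 : ℝ) (3 / 4)) (hlam : 0 < lam) (hL : 0 < L) (hL' : 0 < L')
    (f : Matrix (Fin n) (Fin p) ℝ → ℝ)
    (gradf : Matrix (Fin n) (Fin p) ℝ → Matrix (Fin n) (Fin p) ℝ)
    (hC2 : ContDiff ℝ 2 f)
    (hgrad : ∀ Y H : Matrix (Fin n) (Fin p) ℝ, fderiv ℝ f Y H = finner (gradf Y) H)
    (X : Matrix (Fin n) (Fin p) ℝ) (hX : fnorm (Xᵀ * X - 1) ≤ ε)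
    (hgb : fnorm (gradf X) ≤ L')
    (hhess : ∀ H : Matrix (Fin n) (Fin p) ℝ, fnorm (fderiv ℝ gradf X H) ≤ L * fnorm H)
    (hμ : (2 / (3 - 4 * ε)) *
      (L * (1 - ε) + 3 * Real.sqrt (1 + ε) * L' + 2 * max L L' ^ 2 * (1 + ε) / lam) ≤ μ)
    (m : Matrix (Fin n) (Fin p) ℝ → ℝ)
    (hm : ∀ Y : Matrix (Fin n) (Fin p) ℝ,
      m Y = f Y - (1 / 2) * finner (symPart (Yᵀ * gradf Y)) (Yᵀ * Y - 1) + μ * penaltyN Y)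
    (gradm : Matrix (Fin n) (Fin p) ℝ → Matrix (Fin n) (Fin p) ℝ)
    (hgradm : ∀ Y H : Matrix (Fin n) (Fin p) ℝ, fderiv ℝ m Y H = finner (gradm Y) H) :
    ∀ g : Matrix (Fin n) (Fin p) ℝ,
      finner (landingDir lam X g) (gradm X) ≥
        (1 / 4) * fnorm (skewPart (gradf X * Xᵀ) * X) ^ 2 +
          (1 / 4) * fnorm (skewPart (g * Xᵀ) * X) ^ 2 +
            lam * μ * penaltyN X - fnorm (g - gradf X) ^ 2 := by
  intro g
  obtain ⟨hε0, hε1⟩ := hε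
  rw [ge_iff_le, finner_comm, ← hgradm, fderiv_merit hC2 hgrad hm]
  obtain ⟨hw1, hw2⟩ := fnorm_mul_defect_sq_bounds X hX
  have hcross := skew_cross_bound hε0.le hε1.le hX (gradf X) g
  rw [penaltyN, landingDir]
  have hΔt : (Xᵀ * X - 1)ᵀ = Xᵀ * X - 1 := by simp [Matrix.transpose_mul]
  have hS : Xᵀ * X = 1 + (Xᵀ * X - 1) := by abel
  set Δ := Xᵀ * X - 1
  set G := gradf X
  have hΩt := skewPart_transpose (g * Xᵀ)
  set Ω := skewPart (g * Xᵀ)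
  have hGA : finner G (Ω * X) = finner (skewPart (G * Xᵀ)) Ω := by
    rw [finner_skewPart_left _ hΩt, finner_mul_right, Matrix.transpose_transpose]
  have hΔA : finner (X * Δ) (Ω * X) = 0 := finner_mul_symm_skew_mul X hΔt hΩt
  have hsA : finner (X * symPart (Xᵀ * G)) (Ω * X) = 0 :=
    finner_mul_symm_skew_mul X (symPart_transpose _) hΩt
  have hΔΔt : (Δ * Δ)ᵀ = Δ * Δ := by rw [Matrix.transpose_mul, hΔt]
  have hsX : finner (X * symPart (Xᵀ * G)) (X * Δ) = finner G (X * Δ) + finner (G * Δ) (X * Δ) := by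
    rw [finner_mul_left, ← Matrix.mul_assoc, hS, Matrix.add_mul, Matrix.one_mul, finner_add_right,
      finner_symPart_left _ hΔt, finner_symPart_left _ hΔΔt, finner_mul_left, finner_mul_left,
      Matrix.transpose_transpose, finner_mul_right G Δ, hΔt, Matrix.mul_assoc]
  have hwn := fnorm_nonneg (X * Δ)
  have han := fnorm_nonneg (Ω * X)
  have hδn := fnorm_nonneg Δ
  have hGΔ : fnorm (G * Δ) ≤ L' * fnorm Δ :=
    (fnorm_mul_le G Δ).trans (mul_le_mul_of_nonneg_right hgb hδn)
  have hq2 : finner (G * Δ) (Ω * X) ≤ L' * fnorm Δ * fnorm (Ω * X) :=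
    ((le_abs_self _).trans (abs_finner_le _ _)).trans (mul_le_mul_of_nonneg_right hGΔ han)
  have hs0 : 0 ≤ √(1 + ε) := Real.sqrt_nonneg _
  have hw3 : fnorm (X * Δ) ≤ √(1 + ε) * fnorm Δ := by
    apply le_of_sq_le_sq _ (by positivity)
    rw [mul_pow, Real.sq_sqrt (by linarith)]
    exact hw2
  have hq3 : finner (G * Δ) (X * Δ) ≤ √(1 + ε) * L' * fnorm Δ ^ 2 := by
    refine ((le_abs_self _).trans (abs_finner_le _ _)).trans
      ((mul_le_mul hGΔ hw3 hwn (by positivity)).trans_eq ?_)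
    ring
  have hq4 : finner (fderiv ℝ gradf X (Ω * X)) (X * Δ) ≤ L * fnorm (Ω * X) * fnorm (X * Δ) :=
    ((le_abs_self _).trans (abs_finner_le _ _)).trans
      (mul_le_mul_of_nonneg_right (hhess _) hwn)
  have hq5 : finner (fderiv ℝ gradf X (X * Δ)) (X * Δ) ≤ L * fnorm (X * Δ) * fnorm (X * Δ) :=
    ((le_abs_self _).trans (abs_finner_le _ _)).trans
      (mul_le_mul_of_nonneg_right (hhess _) hwn)
  have hbudget := penalty_budget (Q := max L L' ^ 2 * (1 + ε)) (δ := fnorm Δ) hε1 hlam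
    hL.le hL'.le hs0 (by positivity) (by simpa only [mul_assoc] using hμ) hw1
  have hct := cross_term_bound (L' := L') hε0.le hε1 hL.le hδn hwn han
  simp only [finner_add_right, finner_smul_right, map_add, map_smul, finner_add_left,
    finner_smul_left, hGA, hΔA, hsA, hsX, ← fnorm_sq (X * Δ)]
  have hq3' := mul_le_mul_of_nonneg_left hq3 hlam.le
  have hq5' := mul_le_mul_of_nonneg_left hq5 hlam.le
  nlinarith [hq2, hq3', hq4, hq5', hbudget, hct, hcross]
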